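/- For every n ≥ 0 and all integers a, b, c ≥ 0, the number of partitions π of [n] with cr(π) = a, ne(π) = b and al(π) = c equals the number of partitions π of [n] with cr(π) = b, ne(π) = a and al(π) = c. Equivalently, Σ_{π ∈ Π_n} p^{cr(π)} q^{ne(π)} t^{al(π)} = Σ_{π ∈ Π_n} p^{ne(π)} q^{cr(π)} t^{al(π)}. -/

import Mathlib

open Finset

/-- A set partition of `[n] = {1,…,n}`, modeled as a `Finpartition` of `Fin n`. -/
abbrev SetPartition (n : ℕ) := Finpartition (Finset.univ : Finset (Fin n))

/-- `(i,j)` is an arc of the partition `p`: `i < j`, they lie in a common block,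
and no element of that block lies strictly between them. -/
def IsArc {n : ℕ} (p : SetPartition n) (i j : Fin n) : Prop :=
  i < j ∧ ∃ B ∈ p.parts, i ∈ B ∧ j ∈ B ∧ ∀ x ∈ B, ¬ (i < x ∧ x < j)

/-- Arcs `a = (i₁,j₁)` and `b = (i₂,j₂)` form a crossing: `i₁ < i₂ < j₁ < j₂`. -/
def Crossing {n : ℕ} (a b : Fin n × Fin n) : Prop :=
  a.1 < b.1 ∧ b.1 < a.2 ∧ a.2 < b.2

/-- Arcs `a = (i₁,j₁)` and `b = (i₂,j₂)` form a nesting: `i₁ < i₂ < j₂ < j₁`. -/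
def Nesting {n : ℕ} (a b : Fin n × Fin n) : Prop :=
  a.1 < b.1 ∧ b.1 < b.2 ∧ b.2 < a.2

/-- `cr p`: the number of crossings of two arcs in `p`. -/
noncomputable def cr {n : ℕ} (p : SetPartition n) : ℕ :=
  {e : (Fin n × Fin n) × (Fin n × Fin n) |
    IsArc p e.1.1 e.1.2 ∧ IsArc p e.2.1 e.2.2 ∧ Crossing e.1 e.2}.ncard

/-- `ne' p`: the number of nestings of two arcs in `p`. -/
noncomputable def ne' {n : ℕ} (p : SetPartition n) : ℕ :=
  {e : (Fin n × Fin n) × (Fin n × Fin n) |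
    IsArc p e.1.1 e.1.2 ∧ IsArc p e.2.1 e.2.2 ∧ Nesting e.1 e.2}.ncard

/-- `al p`: the number of alignments (unordered pairs of arcs that neither
cross nor nest, counted with first endpoints in increasing order). -/
noncomputable def al {n : ℕ} (p : SetPartition n) : ℕ :=
  {e : (Fin n × Fin n) × (Fin n × Fin n) |
    IsArc p e.1.1 e.1.2 ∧ IsArc p e.2.1 e.2.2 ∧ e.1.1 < e.2.1 ∧
    ¬ Crossing e.1 e.2 ∧ ¬ Crossing e.2 e.1 ∧
    ¬ Nesting e.1 e.2 ∧ ¬ Nesting e.2 e.1}.ncard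

/-- `i` and `j` lie in a common block of `p`. -/
def InSameBlock {n : ℕ} (p : SetPartition n) (i j : Fin n) : Prop :=
  ∃ B ∈ p.parts, i ∈ B ∧ j ∈ B

/-- `c` (a partition of `[n+1]`) is a child of `p` (a partition of `[n]`):
deleting the element `1` from `c` and shifting down by one yields `p`. -/
def IsChild {n : ℕ} (c : SetPartition (n + 1)) (p : SetPartition n) : Prop :=
  ∀ i j : Fin n, (InSameBlock p i j ↔ InSameBlock c i.succ j.succ)

/-- `level p l` is `T(p, l)`: the set of partitions of `[n+l]` at the `l`-th level of
the subtree rooted at `p` in the tree of partitions. -/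
def level {n : ℕ} (p : SetPartition n) : (l : ℕ) → Set (SetPartition (n + l))
  | 0 => {p}
  | l + 1 => {c | ∃ q ∈ level p l, IsChild c q}

/-- The statistic `s_{α,β}(p) = cr(p)·α + ne(p)·β`. -/
noncomputable def statS {G : Type*} [AddCommGroup G] (α β : G) {n : ℕ} (p : SetPartition n) : G :=
  cr p • α + ne' p • β


/-! ### Arc sets

A set partition of `Fin n` is determined by its set of arcs, and the sets of pairs `(i, j)`, `i < j`,
that arise are those in which no two pairs share a left end or a right end. The arc sets are
enumerated by scanning the right ends from left to right: if `k` arcs are open when the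
point `s` is reached, closing at `s` the one with exactly `r` open arcs to its left creates `r`
nestings and `k - 1 - r` crossings. -/

section ArcSets

variable {n : ℕ}

open Classical in
/-- The number of ordered pairs of elements of `A` related by `R`. -/
noncomputable def pairCount (R : Fin n × Fin n → Fin n × Fin n → Prop)
    (A : Finset (Fin n × Fin n)) : ℕ :=
  ∑ e ∈ A, ∑ f ∈ A, if R e f then 1 else 0

open Classical in
/-- The arc sets with left ends in `O ∪ L`, right ends in `S`, and every element of `O` used as
a left end. -/
noncomputable def arcSets (O L S : Finset (Fin n)) : Finset (Finset (Fin n × Fin n)) :=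
  ((O ∪ L) ×ˢ S).powerset.filter fun A =>
    (∀ e ∈ A, e.1 < e.2) ∧ (∀ e ∈ A, ∀ f ∈ A, e.1 = f.1 → e = f) ∧
      (∀ e ∈ A, ∀ f ∈ A, e.2 = f.2 → e = f) ∧ ∀ i ∈ O, ∃ e ∈ A, e.1 = i

lemma mem_arcSets {O L S : Finset (Fin n)} {A : Finset (Fin n × Fin n)} :
    A ∈ arcSets O L S ↔ (∀ e ∈ A, (e.1 ∈ O ∨ e.1 ∈ L) ∧ e.2 ∈ S) ∧
      (∀ e ∈ A, e.1 < e.2) ∧ (∀ e ∈ A, ∀ f ∈ A, e.1 = f.1 → e = f) ∧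
      (∀ e ∈ A, ∀ f ∈ A, e.2 = f.2 → e = f) ∧ ∀ i ∈ O, ∃ e ∈ A, e.1 = i := by
  simp only [arcSets, Finset.mem_filter, Finset.mem_powerset, Finset.subset_iff,
    Finset.mem_product, Finset.mem_union]

/-- The sum of `φ cr ne m` over all ways to complete `k` open arcs with `m` further points, where
`cr`, `ne`, `m` are the numbers of crossings, nestings and arcs. -/
def completionSum : ℕ → ℕ → (ℕ → ℕ → ℕ → ℕ) → ℕ
  | 0, 0, φ => φ 0 0 0
  | 0, _ + 1, _ => 0
  | m + 1, k, φ => completionSum m k φ + completionSum m (k + 1) φ +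
      ∑ r ∈ range k,
        (completionSum m (k - 1) (fun x y z => φ (x + (k - 1 - r)) (y + r) (z + 1)) +
          completionSum m k (fun x y z => φ (x + (k - 1 - r)) (y + r) (z + 1)))

lemma completionSum_swap (m k : ℕ) (φ : ℕ → ℕ → ℕ → ℕ) :
    completionSum m k (fun x y z => φ y x z) = completionSum m k φ := by
  induction m generalizing k φ with
  | zero => cases k <;> rfl
  | succ m ih =>
    simp only [completionSum]
    rw [← ih k φ, ← ih (k + 1) φ]
    congr 1
    conv_rhs => rw [← Finset.sum_range_reflect]
    refine Finset.sum_congr rfl fun r hr => ?_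
    have hr' : k - 1 - (k - 1 - r) = r := by have := Finset.mem_range.1 hr; omega
    rw [hr', ← ih (k - 1), ← ih k]

lemma sum_card_gt_card_lt (O : Finset (Fin n)) (g : ℕ → ℕ → ℕ) :
    ∑ i ∈ O, g (#{x ∈ O | i < x}) (#{x ∈ O | x < i}) =
      ∑ r ∈ range #O, g (#O - 1 - r) r := by
  induction O using Finset.induction_on_max generalizing g with
  | empty => simp
  | insert a O ha ih =>
    have haO : a ∉ O := fun h => lt_irrefl _ (ha a h)
    rw [Finset.sum_insert haO, Finset.card_insert_of_notMem haO, Finset.sum_range_succ, add_comm]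
    congr 1
    · have := ih fun x y => g (x + 1) y
      rw [Finset.sum_congr rfl (g := fun r => g (#O - 1 - r + 1) r), ← this]
      · refine Finset.sum_congr rfl fun i hi => ?_
        rw [Finset.filter_insert, if_pos (ha i hi), Finset.filter_insert,
          if_neg (ha i hi).not_gt, Finset.card_insert_of_notMem (by simp [haO])]
      · intro r hr
        have := Finset.mem_range.1 hr
        congr 1
        omega
    · rw [Finset.filter_insert, if_neg (lt_irrefl a), Finset.filter_insert, if_neg (lt_irrefl a),
        Finset.filter_false_of_mem fun x hx => (ha x hx).not_gt, Finset.filter_true_of_mem ha]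
      simp

lemma arcSets_insert_left {O S : Finset (Fin n)} {s : Fin n} (hO : s ∉ O) (hS : s ∉ S)
    (φ : Finset (Fin n × Fin n) → ℕ) :
    ∑ A ∈ arcSets O (insert s S) S, φ A =
      ∑ A ∈ arcSets O S S, φ A + ∑ A ∈ arcSets (insert s O) S S, φ A := by
  rw [← Finset.sum_filter_not_add_sum_filter (arcSets O (insert s S) S) fun A => ∃ e ∈ A, e.1 = s]
  congr 2
  · ext A
    simp only [Finset.mem_filter, mem_arcSets, Finset.mem_insert]
    constructor <;> grind
  · ext A
    simp only [Finset.mem_filter, mem_arcSets, Finset.mem_insert]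
    constructor <;> grind

open Classical in
lemma pairCount_insert {R : Fin n × Fin n → Fin n × Fin n → Prop} {A : Finset (Fin n × Fin n)}
    {a : Fin n × Fin n} (ha : a ∉ A) (hR : ¬ R a a) :
    pairCount R (insert a A) = pairCount R A + #{f ∈ A | R a f} + #{e ∈ A | R e a} := by
  simp only [pairCount, Finset.sum_insert ha, hR, if_false, Finset.sum_add_distrib,
    Finset.card_filter]
  ring

lemma card_filter_arcs_eq {O L S : Finset (Fin n)} {A : Finset (Fin n × Fin n)}
    (hA : A ∈ arcSets O L S) (P : Fin n × Fin n → Prop) [DecidablePred P]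
    (Q : Fin n → Prop) [DecidablePred Q] (hP : ∀ e ∈ A, P e ↔ e.1 ∈ O ∧ Q e.1) :
    #{e ∈ A | P e} = #{i ∈ O | Q i} := by
  rw [mem_arcSets] at hA
  obtain ⟨-, -, hl, -, hc⟩ := hA
  refine Finset.card_nbij Prod.fst ?_ ?_ ?_
  · intro e he
    have he := Finset.mem_filter.1 he
    exact Finset.mem_filter.2 ((hP e he.1).1 he.2)
  · intro e he f hf h
    exact hl e (Finset.mem_filter.1 he).1 f (Finset.mem_filter.1 hf).1 h
  · intro i hi
    have hi := Finset.mem_filter.1 hi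
    obtain ⟨e, he, rfl⟩ := hc i hi.1
    exact ⟨e, Finset.mem_filter.2 ⟨he, (hP e he).2 hi⟩, rfl⟩

section Step

variable {O S : Finset (Fin n)} {s i : Fin n} {A : Finset (Fin n × Fin n)}

lemma pairCount_crossing_insert (hO : ∀ x ∈ O, x < s) (hS : ∀ x ∈ S, s < x)
    (hA : A ∈ arcSets (O.erase i) (insert s S) S) :
    pairCount Crossing (insert (i, s) A) = pairCount Crossing A + #{x ∈ O | i < x} := by
  classical
  have hA' := mem_arcSets.1 hA
  have h1 : (i, s) ∉ A := fun h => lt_irrefl _ (hS _ (hA'.1 _ h).2)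
  rw [pairCount_insert h1 fun h => lt_irrefl _ h.1,
    card_filter_arcs_eq hA (fun f => Crossing (i, s) f) (fun x => i < x), add_assoc]
  · have h2 : {e ∈ A | Crossing e (i, s)} = ∅ := Finset.filter_false_of_mem fun e he h =>
      (hS _ (hA'.1 e he).2).not_gt h.2.2
    rw [h2, Finset.card_empty, add_zero]
    congr 2
    ext x
    simp only [Finset.mem_filter, Finset.mem_erase]
    grind
  · intro e he
    have := hA'.1 e he
    simp only [Crossing]
    grind

lemma pairCount_nesting_insert (hO : ∀ x ∈ O, x < s) (hS : ∀ x ∈ S, s < x) (hi : i ∈ O)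
    (hA : A ∈ arcSets (O.erase i) (insert s S) S) :
    pairCount Nesting (insert (i, s) A) = pairCount Nesting A + #{x ∈ O | x < i} := by
  classical
  have hA' := mem_arcSets.1 hA
  have h1 : (i, s) ∉ A := fun h => lt_irrefl _ (hS _ (hA'.1 _ h).2)
  rw [pairCount_insert h1 fun h => lt_irrefl _ h.1,
    card_filter_arcs_eq hA (fun e => Nesting e (i, s)) (fun x => x < i)]
  · have h2 : {f ∈ A | Nesting (i, s) f} = ∅ := Finset.filter_false_of_mem fun e he h =>
      (hS _ (hA'.1 e he).2).not_gt h.2.2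
    rw [h2, Finset.card_empty, add_zero]
    congr 2
    ext x
    simp only [Finset.mem_filter, Finset.mem_erase]
    grind
  · intro e he
    have := hA'.1 e he
    simp only [Nesting]
    grind

lemma sum_arcSets_insert (hO : ∀ x ∈ O, x < s) (hS : ∀ x ∈ S, s < x)
    (φ : Finset (Fin n × Fin n) → ℕ) :
    ∑ A ∈ arcSets O (insert s S) (insert s S), φ A =
      ∑ A ∈ arcSets O (insert s S) S, φ A +
        ∑ i ∈ O, ∑ A ∈ arcSets (O.erase i) (insert s S) S, φ (insert (i, s) A) := by
  classical
  rw [← Finset.sum_filter_not_add_sum_filter (arcSets O (insert s S) (insert s S))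
    fun A => ∃ i ∈ O, (i, s) ∈ A]
  congr 1
  · congr 1
    ext A
    simp only [Finset.mem_filter, mem_arcSets]
    grind
  · have h : {A ∈ arcSets O (insert s S) (insert s S) | ∃ i ∈ O, (i, s) ∈ A} =
        O.biUnion fun i => {A ∈ arcSets O (insert s S) (insert s S) | (i, s) ∈ A} := by
      ext A
      simp only [Finset.mem_filter, Finset.mem_biUnion]
      tauto
    rw [h, Finset.sum_biUnion]
    · refine Finset.sum_congr rfl fun i hi => ?_
      refine Finset.sum_nbij' (fun A => A.erase (i, s)) (fun A => insert (i, s) A) ?_ ?_ ?_ ?_ ?_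
      · intro A
        simp only [Finset.mem_filter, mem_arcSets, Finset.mem_insert, Finset.mem_erase]
        rintro ⟨⟨h1, h2, h3, h4, h5⟩, h6⟩
        refine ⟨?_, by grind, by grind, by grind, ?_⟩
        · rintro e ⟨hne, he⟩
          have := h1 e he
          have := h3 e he _ h6
          have := h4 e he _ h6
          grind
        · rintro j ⟨hj, hjO⟩
          obtain ⟨e, he, rfl⟩ := h5 j hjO
          exact ⟨e, ⟨fun h => hj (congrArg Prod.fst h), he⟩, rfl⟩
      · intro A
        simp only [Finset.mem_filter, mem_arcSets, Finset.mem_insert, Finset.mem_erase]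
        rintro ⟨h1, h2, h3, h4, h5⟩
        have hil : ∀ e ∈ A, e.1 ≠ i := by
          intro e he h
          have := (h1 e he).1
          have := hO i hi
          grind
        have hsr : ∀ e ∈ A, e.2 ≠ s := fun e he h => (hS _ (h1 e he).2).ne' h
        refine ⟨⟨?_, ?_, ?_, ?_, ?_⟩, Or.inl trivial⟩
        · rintro e (rfl | he)
          · exact ⟨Or.inl hi, Or.inl rfl⟩
          · have := h1 e he
            tauto
        · rintro e (rfl | he)
          · exact hO i hi
          · exact h2 e he
        · rintro e (rfl | he) f (rfl | hf) h
          · rfl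
          · exact absurd h.symm (hil f hf)
          · exact absurd h (hil e he)
          · exact h3 e he f hf h
        · rintro e (rfl | he) f (rfl | hf) h
          · rfl
          · exact absurd h.symm (hsr f hf)
          · exact absurd h (hsr e he)
          · exact h4 e he f hf h
        · intro j hj
          by_cases hji : j = i
          · exact ⟨(i, s), Or.inl rfl, hji.symm⟩
          · obtain ⟨e, he, hej⟩ := h5 j ⟨hji, hj⟩
            exact ⟨e, Or.inr he, hej⟩
      · intro A hA
        exact Finset.insert_erase (Finset.mem_filter.1 hA).2
      · intro A hA
        exact Finset.erase_insert fun h => lt_irrefl _ (hS _ ((mem_arcSets.1 hA).1 _ h).2)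
      · intro A hA
        rw [Finset.insert_erase (Finset.mem_filter.1 hA).2]
    · intro i _ j _ hij
      refine Finset.disjoint_left.2 fun A hA hB => hij ?_
      simp only [Finset.mem_filter, mem_arcSets] at hA hB
      exact congrArg Prod.fst (hA.1.2.2.2.1 _ hA.2 _ hB.2 rfl)

end Step

lemma sum_arcSets_eq_completionSum (O S : Finset (Fin n)) (h : ∀ x ∈ O, ∀ y ∈ S, x < y)
    (φ : ℕ → ℕ → ℕ → ℕ) :
    ∑ A ∈ arcSets O S S, φ (pairCount Crossing A) (pairCount Nesting A) #A =
      completionSum #S #O φ := by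
  induction S using Finset.induction_on_min generalizing O φ with
  | empty =>
    rcases O.eq_empty_or_nonempty with rfl | ⟨i, hi⟩
    · have : arcSets (∅ : Finset (Fin n)) ∅ ∅ = {∅} := by
        ext A
        simp only [mem_arcSets, Finset.mem_singleton, Finset.eq_empty_iff_forall_notMem]
        grind
      simp [this, pairCount, completionSum]
    · have : arcSets O (∅ : Finset (Fin n)) ∅ = ∅ := by
        ext A
        simp only [mem_arcSets, Finset.notMem_empty]
        grind
      obtain ⟨k, hk⟩ : ∃ k, #O = k + 1 :=
        Nat.exists_eq_succ_of_ne_zero (Finset.card_pos.2 ⟨i, hi⟩).ne'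
      simp [this, hk, completionSum]
  | insert s S hS ih =>
    have hO : ∀ x ∈ O, x < s := fun x hx => h x hx s (Finset.mem_insert_self _ _)
    have hsS : s ∉ S := fun hs => lt_irrefl _ (hS s hs)
    have hsO : s ∉ O := fun hs => lt_irrefl _ (hO s hs)
    have key : ∀ U ⊆ O, ∀ ψ : ℕ → ℕ → ℕ → ℕ,
        ∑ A ∈ arcSets U (insert s S) S, ψ (pairCount Crossing A) (pairCount Nesting A) #A =
          completionSum #S #U ψ + completionSum #S (#U + 1) ψ := by
      intro U hU ψ
      rw [arcSets_insert_left (fun hs => hsO (hU hs)) hsS, ih, ih,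
        Finset.card_insert_of_notMem fun hs => hsO (hU hs)]
      · intro x hx y hy
        rcases Finset.mem_insert.1 hx with rfl | hx
        · exact hS y hy
        · exact (hO x (hU hx)).trans (hS y hy)
      · exact fun x hx y hy => (hO x (hU hx)).trans (hS y hy)
    rw [sum_arcSets_insert hO hS, key O subset_rfl, Finset.card_insert_of_notMem hsS, completionSum]
    congr 1
    rw [← sum_card_gt_card_lt O fun u v =>
      completionSum #S (#O - 1) (fun x y z => φ (x + u) (y + v) (z + 1)) +
        completionSum #S #O (fun x y z => φ (x + u) (y + v) (z + 1))]
    refine Finset.sum_congr rfl fun i hi => ?_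
    have hc : #O - 1 + 1 = #O := Nat.sub_add_cancel (Finset.card_pos.2 ⟨i, hi⟩)
    have := key (O.erase i) (Finset.erase_subset _ _) fun x y z =>
      φ (x + #{x ∈ O | i < x}) (y + #{x ∈ O | x < i}) (z + 1)
    rw [Finset.card_erase_of_mem hi, hc] at this
    rw [← this]
    refine Finset.sum_congr rfl fun A hA => ?_
    rw [pairCount_crossing_insert hO hS hA, pairCount_nesting_insert hO hS hi hA,
      Finset.card_insert_of_notMem fun h => lt_irrefl _ (hS _ ((mem_arcSets.1 hA).1 _ h).2)]

lemma two_mul_pairCount_lt_add_card {A : Finset (Fin n × Fin n)}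
    (hA : ∀ e ∈ A, ∀ f ∈ A, e.1 = f.1 → e = f) :
    2 * pairCount (fun e f => e.1 < f.1) A + #A = #A * #A := by
  classical
  have hcomm : pairCount (fun e f => e.1 < f.1) A = pairCount (fun e f => f.1 < e.1) A :=
    Finset.sum_comm
  have hdiag : #A = pairCount (fun e f => e = f) A := by
    rw [Finset.card_eq_sum_ones, pairCount]
    refine Finset.sum_congr rfl fun e he => ?_
    rw [Finset.sum_eq_single_of_mem e he]
    · simp
    · intro f _ hf
      simp [hf.symm]
  have hall : #A * #A = pairCount (fun _ _ => True) A := by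
    simp [pairCount]
  rw [two_mul]
  nth_rewrite 2 [hcomm]
  rw [hall, hdiag]
  simp only [pairCount, ← Finset.sum_add_distrib]
  refine Finset.sum_congr rfl fun e he => Finset.sum_congr rfl fun f hf => ?_
  have := hA e he f hf
  rcases lt_trichotomy e.1 f.1 with h | h | h
  · have : e ≠ f := fun hh => h.ne (congrArg Prod.fst hh)
    simp [h, h.not_gt, this]
  · simp [this h]
  · have : e ≠ f := fun hh => h.ne' (congrArg Prod.fst hh)
    simp [h, h.not_gt, this]

lemma ncard_setOf_pair (R : Fin n × Fin n → Fin n × Fin n → Prop) (A : Finset (Fin n × Fin n)) :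
    {e : (Fin n × Fin n) × (Fin n × Fin n) | e.1 ∈ A ∧ e.2 ∈ A ∧ R e.1 e.2}.ncard =
      pairCount R A := by
  classical
  have : {e : (Fin n × Fin n) × (Fin n × Fin n) | e.1 ∈ A ∧ e.2 ∈ A ∧ R e.1 e.2} =
      ((A ×ˢ A).filter fun e => R e.1 e.2 : Finset _) := by
    ext e
    simp [and_assoc]
  rw [this, Set.ncard_coe_finset, Finset.card_filter, Finset.sum_product]
  rfl

/-! ### From partitions to arc sets -/

open Classical in
/-- The set of arcs of a partition. -/
noncomputable def arcs (p : SetPartition n) : Finset (Fin n × Fin n) :=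
  {e | IsArc p e.1 e.2}

lemma mem_arcs {p : SetPartition n} {e : Fin n × Fin n} : e ∈ arcs p ↔ IsArc p e.1 e.2 := by
  simp [arcs]

lemma cr_eq_pairCount (p : SetPartition n) : cr p = pairCount Crossing (arcs p) := by
  rw [← ncard_setOf_pair]
  simp only [mem_arcs, cr]

lemma ne'_eq_pairCount (p : SetPartition n) : ne' p = pairCount Nesting (arcs p) := by
  rw [← ncard_setOf_pair]
  simp only [mem_arcs, ne']

lemma InSameBlock.symm {p : SetPartition n} {i j : Fin n} (h : InSameBlock p i j) :
    InSameBlock p j i := by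
  obtain ⟨B, hB, hi, hj⟩ := h
  exact ⟨B, hB, hj, hi⟩

lemma InSameBlock.trans {p : SetPartition n} {i j k : Fin n} (h : InSameBlock p i j)
    (h' : InSameBlock p j k) : InSameBlock p i k := by
  obtain ⟨B, hB, hi, hj⟩ := h
  obtain ⟨C, hC, hj', hk⟩ := h'
  obtain rfl := p.disjoint.elim_finset hB hC j hj hj'
  exact ⟨B, hB, hi, hk⟩

lemma InSameBlock.refl (p : SetPartition n) (i : Fin n) : InSameBlock p i i := by
  obtain ⟨B, hB, hi⟩ := p.exists_mem (Finset.mem_univ i)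
  exact ⟨B, hB, hi, hi⟩

lemma isArc_iff {p : SetPartition n} {i j : Fin n} :
    IsArc p i j ↔ i < j ∧ InSameBlock p i j ∧ ∀ x, InSameBlock p i x → ¬ (i < x ∧ x < j) := by
  constructor
  · rintro ⟨h, B, hB, hi, hj, hx⟩
    refine ⟨h, ⟨B, hB, hi, hj⟩, ?_⟩
    rintro x ⟨C, hC, hi', hx'⟩
    obtain rfl := p.disjoint.elim_finset hB hC i hi hi'
    exact hx x hx'
  · rintro ⟨h, ⟨B, hB, hi, hj⟩, hx⟩
    exact ⟨h, B, hB, hi, hj, fun x hxB => hx x ⟨B, hB, hi, hxB⟩⟩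

lemma arcs_mem_arcSets (p : SetPartition n) : arcs p ∈ arcSets ∅ univ univ := by
  rw [mem_arcSets]
  simp only [mem_arcs, isArc_iff]
  refine ⟨by simp, fun e he => he.1, ?_, ?_, by simp⟩
  · rintro ⟨i, j⟩ ⟨h1, h2, h3⟩ ⟨i', j'⟩ ⟨h1', h2', h3'⟩ (rfl : i = i')
    have := h3 _ h2'
    have := h3' _ h2
    grind
  · rintro ⟨i, j⟩ ⟨h1, h2, h3⟩ ⟨i', j'⟩ ⟨h1', h2', h3'⟩ (rfl : j = j')
    have := h3 _ (h2.trans h2'.symm)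
    have := h3' _ (h2'.trans h2.symm)
    grind

lemma pairCount_add_al (p : SetPartition n) :
    cr p + ne' p + al p = pairCount (fun e f => e.1 < f.1) (arcs p) := by
  classical
  have hal : al p = pairCount (fun e f => e.1 < f.1 ∧ ¬ Crossing e f ∧ ¬ Crossing f e ∧
      ¬ Nesting e f ∧ ¬ Nesting f e) (arcs p) := by
    rw [← ncard_setOf_pair]
    simp only [mem_arcs, al]
  rw [hal, cr_eq_pairCount, ne'_eq_pairCount]
  simp only [pairCount, ← Finset.sum_add_distrib]
  refine Finset.sum_congr rfl fun e he => Finset.sum_congr rfl fun f hf => ?_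
  obtain ⟨-, -, -, h, -⟩ := mem_arcSets.1 (arcs_mem_arcSets p)
  have := h e he f hf
  simp only [Crossing, Nesting]
  grind

lemma al_eq (p : SetPartition n) :
    al p = (#(arcs p) * #(arcs p) - #(arcs p)) / 2 - cr p - ne' p := by
  have h1 := pairCount_add_al p
  have h2 := two_mul_pairCount_lt_add_card (mem_arcSets.1 (arcs_mem_arcSets p)).2.2.1
  omega

lemma setPartition_ext {p q : SetPartition n}
    (h : ∀ i j, InSameBlock p i j ↔ InSameBlock q i j) : p = q := by
  have key : ∀ p q : SetPartition n, (∀ i j, InSameBlock p i j ↔ InSameBlock q i j) →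
      p.parts ⊆ q.parts := by
    intro p q h B hB
    obtain ⟨i, hi⟩ := p.nonempty_of_mem_parts hB
    obtain ⟨C, hC, hi'⟩ := q.exists_mem (Finset.mem_univ i)
    have : B = C := by
      ext x
      constructor
      · intro hx
        obtain ⟨D, hD, h1, h2⟩ := (h i x).1 ⟨B, hB, hi, hx⟩
        rwa [q.disjoint.elim_finset hC hD i hi' h1]
      · intro hx
        obtain ⟨D, hD, h1, h2⟩ := (h i x).2 ⟨C, hC, hi', hx⟩
        rwa [p.disjoint.elim_finset hB hD i hi h1]
    rwa [this]
  exact Finpartition.ext (Finset.Subset.antisymm (key p q h) (key q p fun i j => (h i j).symm))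

lemma inSameBlock_of_isArc_imp {p q : SetPartition n} (h : ∀ i j, IsArc p i j → IsArc q i j)
    {i j : Fin n} (hij : i ≤ j) (hp : InSameBlock p i j) : InSameBlock q i j := by
  induction j using WellFoundedLT.induction generalizing i with
  | ind j ih =>
    rcases hij.eq_or_lt with rfl | hlt
    · exact InSameBlock.refl q i
    classical
    let T : Finset (Fin n) := {x | x < j ∧ InSameBlock p x j}
    have hT : T.Nonempty := ⟨i, by simp [T, hlt, hp]⟩
    have hm := Finset.max'_mem T hT
    have hle : i ≤ T.max' hT := T.le_max' i (by simp [T, hlt, hp])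
    have hmax : ∀ x ∈ T, x ≤ T.max' hT := fun x => T.le_max' x
    generalize T.max' hT = m at hm hle hmax
    have hm' : m < j ∧ InSameBlock p m j := by simpa [T] using hm
    have harc : IsArc p m j := by
      refine isArc_iff.2 ⟨hm'.1, hm'.2, fun x hx hmx => ?_⟩
      have : x ∈ T := by simp [T, hmx.2, hx.symm.trans hm'.2]
      exact (hmax x this).not_gt hmx.1
    exact (ih m hm'.1 hle (hp.trans hm'.2.symm)).trans (isArc_iff.1 (h m j harc)).2.1

lemma arcs_injective : Function.Injective (arcs : SetPartition n → _) := by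
  intro p q hpq
  have h : ∀ i j, IsArc p i j ↔ IsArc q i j := fun i j => by
    rw [← mem_arcs (e := (i, j)), hpq, mem_arcs]
  refine setPartition_ext fun i j => ?_
  rcases le_total i j with hij | hij
  · exact ⟨inSameBlock_of_isArc_imp (fun i j => (h i j).1) hij,
      inSameBlock_of_isArc_imp (fun i j => (h i j).2) hij⟩
  · exact ⟨fun hp => (inSameBlock_of_isArc_imp (fun i j => (h i j).1) hij hp.symm).symm,
      fun hp => (inSameBlock_of_isArc_imp (fun i j => (h i j).2) hij hp.symm).symm⟩

open Relation in
lemma exists_arcs_eq {A : Finset (Fin n × Fin n)} (hA : A ∈ arcSets ∅ univ univ) :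
    ∃ p : SetPartition n, arcs p = A := by
  classical
  obtain ⟨-, hlt, hl, hr, -⟩ := mem_arcSets.1 hA
  let R : Fin n → Fin n → Prop := fun i j => (i, j) ∈ A
  have hR : ∀ {i j k}, R i j → R i k → j = k := fun h h' => congrArg Prod.snd (hl _ h _ h' rfl)
  have hL : ∀ {i j k}, R i k → R j k → i = j := fun h h' => congrArg Prod.fst (hr _ h _ h' rfl)
  have hle : ∀ {i j}, ReflTransGen R i j → i ≤ j := by
    intro i j h
    induction h with
    | refl => exact le_rfl
    | tail _ h ih => exact ih.trans (hlt _ h).le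
  let r : Setoid (Fin n) :=
    { r := fun i j => ReflTransGen R i j ∨ ReflTransGen R j i
      iseqv :=
        { refl := fun i => Or.inl .refl
          symm := Or.symm
          trans := by
            rintro i j k (h | h) (h' | h')
            · exact Or.inl (h.trans h')
            · have h1 := (reflTransGen_swap).2 h
              have h2 := (reflTransGen_swap).2 h'
              have hu : Relator.RightUnique (Function.swap R) := fun a b c hb hc => hL hb hc
              rcases ReflTransGen.total_of_right_unique hu h1 h2 with h3 | h3
              · exact Or.inr (reflTransGen_swap.1 h3)
              · exact Or.inl (reflTransGen_swap.1 h3)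
            · have hu : Relator.RightUnique R := fun a b c hb hc => hR hb hc
              exact ReflTransGen.total_of_right_unique hu h h'
            · exact Or.inr (h'.trans h) } }
  have hblock : ∀ i j, InSameBlock (Finpartition.ofSetoid r) i j ↔
      ReflTransGen R i j ∨ ReflTransGen R j i := by
    intro i j
    have : (ReflTransGen R i j ∨ ReflTransGen R j i) ↔ r i j := Iff.rfl
    rw [this, ← Finpartition.mem_part_ofSetoid_iff_rel]
    constructor
    · rintro ⟨B, hB, hi, hj⟩
      rwa [Finpartition.part_eq_of_mem _ hB hi]
    · intro h
      exact ⟨_, Finpartition.part_mem _ |>.2 (Finset.mem_univ i),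
        Finpartition.mem_part _ (Finset.mem_univ i), h⟩
  refine ⟨Finpartition.ofSetoid r, ?_⟩
  ext ⟨i, j⟩
  rw [mem_arcs, isArc_iff]
  simp only [hblock]
  constructor
  · rintro ⟨h1, h2, h3⟩
    have h2 : ReflTransGen R i j := h2.resolve_right fun h => (hle h).not_gt h1
    rcases h2.cases_head with rfl | ⟨k, hik, hkj⟩
    · exact absurd h1 (lt_irrefl _)
    · rcases (hle hkj).eq_or_lt with rfl | hlt'
      · exact hik
      · exact absurd ⟨hlt _ hik, hlt'⟩ (h3 k (Or.inl (.single hik)))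
  · intro hij
    refine ⟨hlt _ hij, Or.inl (.single hij), ?_⟩
    rintro x hx ⟨h1, h2⟩
    have hx : ReflTransGen R i x := hx.resolve_right fun h => (hle h).not_gt h1
    rcases hx.cases_head with rfl | ⟨k, hik, hkx⟩
    · exact lt_irrefl _ h1
    · rw [← hR hij hik] at hkx
      exact (hle hkx).not_gt h2

lemma sum_setPartition_eq_completionSum (φ : ℕ → ℕ → ℕ → ℕ) :
    ∑ p : SetPartition n, φ (cr p) (ne' p) #(arcs p) = completionSum n 0 φ := by
  have h := sum_arcSets_eq_completionSum (∅ : Finset (Fin n)) univ (by simp) φ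
  rw [Finset.card_univ, Fintype.card_fin, Finset.card_empty] at h
  rw [← h]
  refine Finset.sum_bij (fun p _ => arcs p) (fun p _ => arcs_mem_arcSets p)
    (fun p _ q _ hpq => arcs_injective hpq) (fun A hA => ?_) fun p _ => ?_
  · obtain ⟨p, hp⟩ := exists_arcs_eq hA
    exact ⟨p, Finset.mem_univ p, hp⟩
  · rw [cr_eq_pairCount, ne'_eq_pairCount]

end ArcSets

/-- Corollary 3.2, Kasraoui–Zeng. The joint distribution of crossings,
nestings and alignments over partitions of `[n]` is symmetric in `cr` and `ne`: for all
`a, b, c`, the number of partitions of `[n]` with `cr = a`, `ne = b`, `al = c` equals the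
number with `cr = b`, `ne = a`, `al = c`. -/
theorem statement8 (n a b c : ℕ) :
    {p : SetPartition n | cr p = a ∧ ne' p = b ∧ al p = c}.ncard =
    {p : SetPartition n | cr p = b ∧ ne' p = a ∧ al p = c}.ncard := by
  classical
  have key : ∀ a b : ℕ, {p : SetPartition n | cr p = a ∧ ne' p = b ∧ al p = c}.ncard =
      completionSum n 0
        (fun x y z => if x = a ∧ y = b ∧ (z * z - z) / 2 - x - y = c then 1 else 0) := by
    intro a b
    rw [← sum_setPartition_eq_completionSum, ← Finset.card_filter, ← Set.ncard_coe_finset]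
    congr 1
    ext p
    simp [al_eq]
  rw [key, key, ← completionSum_swap]
  congr 1
  funext x y z
  rw [Nat.sub_right_comm]
  congr 1
  simp only [eq_iff_iff]
  tauto
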